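/- Let 1 ≤ m ≤ n be integers and let γ be a real number with γ ≠ 0 and γ ≠ 1. Let τ(ω) = −Re(G′(iω)/G(iω)) be the group delay of Budak's function G = G_{mn}^γ along the imaginary axis. Then τ(0) = 1 and the derivatives of τ at ω = 0 of every order 1, 2, …, 2m − 1 vanish; i.e., the delay approximation of G_{mn}^γ is maximally flat of order at least m. -/

import Mathlib

open Polynomial Finset Nat

/-- The classical Bessel polynomial `B_r(s, 2, 1) = Σ_{k=0}^{r} C(r,k) ((r+k)!/r!) s^{r−k}`. -/
noncomputable def besselPoly (r : ℕ) : Polynomial ℝ :=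
  ∑ k ∈ Finset.range (r + 1),
    Polynomial.C ((r.choose k : ℝ) * (((r + k)! : ℝ) / (r ! : ℝ))) * Polynomial.X ^ (r - k)

/-- The constant `K = B_n(0,2,1) / B_m(0,2,1)` in Budak's approximation. -/
noncomputable def budakK (m n : ℕ) : ℝ :=
  (besselPoly n).eval 0 / (besselPoly m).eval 0

/-- Budak's function `G_{mn}^γ(s) = K · B_m(2(γ−1)s, 2, 1) / B_n(2γs, 2, 1)` as a complex
function. -/
noncomputable def budak (m n : ℕ) (γ : ℝ) : ℂ → ℂ := fun z =>
  (budakK m n : ℂ) * Polynomial.aeval (2 * ((γ : ℂ) - 1) * z) (besselPoly m) /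
    Polynomial.aeval (2 * (γ : ℂ) * z) (besselPoly n)

/-- Group delay along the imaginary axis: `τ(ω) = −Re(G′(iω)/G(iω))`. -/
noncomputable def groupDelay (G : ℂ → ℂ) : ℝ → ℝ := fun ω =>
  -(deriv G ((ω : ℂ) * Complex.I) / G ((ω : ℂ) * Complex.I)).re

theorem besselPoly_coeff_of_le {r j : ℕ} (hj : j ≤ r) :
    (besselPoly r).coeff j = ((2 * r - j)! : ℝ) / ((j ! : ℝ) * ((r - j)! : ℝ)) := by
  unfold besselPoly
  rw [finsetSum_coeff, Finset.sum_eq_single (r - j)]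
  · have h1 : r - (r - j) = j := by omega
    have h2 : r + (r - j) = 2 * r - j := by omega
    rw [coeff_C_mul_X_pow, h1, h2, if_pos rfl, Nat.choose_symm hj, Nat.cast_choose ℝ hj]
    have := Nat.factorial_pos r
    field_simp
  · intro k hk hkj
    rw [coeff_C_mul_X_pow, if_neg]
    have := Finset.mem_range.1 hk
    omega
  · intro h
    exact absurd (Finset.mem_range.2 (by omega)) h

theorem besselPoly_coeff_of_lt {r j : ℕ} (hj : r < j) : (besselPoly r).coeff j = 0 := by
  unfold besselPoly
  rw [finsetSum_coeff]
  refine Finset.sum_eq_zero fun k _ => ?_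
  rw [coeff_C_mul_X_pow, if_neg (by omega)]

theorem besselPoly_coeff_succ (r j : ℕ) :
    ((j : ℝ) + 1) * (2 * r - j) * (besselPoly r).coeff (j + 1) =
      ((r : ℝ) - j) * (besselPoly r).coeff j := by
  rcases lt_trichotomy j r with h | rfl | h
  · obtain ⟨d, rfl⟩ := Nat.exists_eq_add_of_lt h
    rw [besselPoly_coeff_of_le (by omega : j + 1 ≤ j + d + 1), besselPoly_coeff_of_le h.le,
      show 2 * (j + d + 1) - j = (j + 2 * d + 1) + 1 by omega,
      show 2 * (j + d + 1) - (j + 1) = j + 2 * d + 1 by omega,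
      show j + d + 1 - (j + 1) = d by omega, show j + d + 1 - j = d + 1 by omega,
      Nat.factorial_succ (j + 2 * d + 1), Nat.factorial_succ d, Nat.factorial_succ j]
    push_cast
    have h1 : (j ! : ℝ) ≠ 0 := by exact_mod_cast Nat.factorial_ne_zero j
    have h2 : (d ! : ℝ) ≠ 0 := by exact_mod_cast Nat.factorial_ne_zero d
    have h3 : (j : ℝ) + 1 ≠ 0 := by positivity
    have h4 : (d : ℝ) + 1 ≠ 0 := by positivity
    field_simp
    ring
  · rw [besselPoly_coeff_of_lt (Nat.lt_succ_self j)]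
    ring
  · rw [besselPoly_coeff_of_lt h, besselPoly_coeff_of_lt (h.trans (Nat.lt_succ_self j))]
    ring

theorem besselPoly_coeff_zero_ne_zero (r : ℕ) : (besselPoly r).coeff 0 ≠ 0 := by
  rw [besselPoly_coeff_of_le (Nat.zero_le r)]
  positivity

theorem besselPoly_ode (r : ℕ) :
    X * derivative (derivative (besselPoly r)) -
      (X + 2 * (r : ℝ[X])) * derivative (besselPoly r) + (r : ℝ[X]) * besselPoly r = 0 := by
  ext j
  have h := besselPoly_coeff_succ r j
  rw [add_mul, mul_assoc, ← Nat.cast_ofNat (R := ℝ[X])]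
  rcases j with _ | j
  · simp [coeff_derivative] at h ⊢
    linarith
  · simp only [coeff_add, coeff_sub, coeff_X_mul, coeff_natCast_mul, coeff_derivative, coeff_zero]
    push_cast at h ⊢
    linarith

theorem eq_C_mul_X_pow_of_X_mul_derivative {W : ℝ[X]} {N : ℕ}
    (h : X * derivative W = (N : ℝ[X]) * W) : W = C (W.coeff N) * X ^ N := by
  ext j
  rw [coeff_C_mul_X_pow]
  split_ifs with hj
  · rw [hj]
  · have h' := congrArg (fun p => coeff p j) h
    have hjN : (j : ℝ) - N ≠ 0 := sub_ne_zero.2 (by exact_mod_cast hj)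
    refine (mul_eq_zero.1 (?_ : ((j : ℝ) - N) * W.coeff j = 0)).resolve_left hjN
    rcases j with _ | j
    · simp at h' ⊢
      tauto
    · simp only [coeff_X_mul, coeff_natCast_mul, coeff_derivative] at h'
      push_cast at h' ⊢
      linarith

theorem besselPoly_wronskian (r : ℕ) : ∃ c : ℝ,
    derivative (besselPoly r) * (besselPoly r).comp (-X) +
      besselPoly r * (derivative (besselPoly r)).comp (-X) -
      besselPoly r * (besselPoly r).comp (-X) = C c * X ^ (2 * r) := by
  refine ⟨_, eq_C_mul_X_pow_of_X_mul_derivative ?_⟩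
  have h1 := besselPoly_ode r
  have h2 := congrArg (fun p : ℝ[X] => p.comp (-X)) h1
  simp only [add_comp, sub_comp, mul_comp, X_comp, natCast_comp, zero_comp, ofNat_comp] at h2
  simp only [derivative_mul, derivative_add, derivative_sub, derivative_comp, derivative_neg,
    derivative_X]
  push_cast
  linear_combination (besselPoly r).comp (-X) * h1 + besselPoly r * h2

/-- The real part of the logarithmic derivative of a Bessel polynomial on the imaginary axis. -/
theorem besselPoly_re_div (r : ℕ) : ∃ c : ℝ, ∀ t : ℝ,
    aeval ((t : ℂ) * Complex.I) (besselPoly r) ≠ 0 →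
    (aeval ((t : ℂ) * Complex.I) (derivative (besselPoly r)) /
      aeval ((t : ℂ) * Complex.I) (besselPoly r)).re =
    1 / 2 + c * t ^ (2 * r) / Complex.normSq (aeval ((t : ℂ) * Complex.I) (besselPoly r)) := by
  obtain ⟨c, hc⟩ := besselPoly_wronskian r
  refine ⟨c * (-1) ^ r / 2, fun t ht => ?_⟩
  have h := congrArg (fun p : ℝ[X] => aeval ((t : ℂ) * Complex.I) p) hc
  have hconj (p : ℝ[X]) : aeval (-((t : ℂ) * Complex.I)) p =
      (starRingEnd ℂ) (aeval ((t : ℂ) * Complex.I) p) := by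
    rw [← Polynomial.aeval_conj]
    simp
  simp only [map_add, map_sub, map_mul, aeval_comp, map_neg, map_pow, aeval_X, aeval_C, hconj] at h
  have hI : ((t : ℂ) * Complex.I) ^ (2 * r) = (((-1) ^ r * t ^ (2 * r) : ℝ) : ℂ) := by
    rw [mul_pow, pow_mul Complex.I, Complex.I_sq]
    push_cast
    ring
  rw [hI, Complex.coe_algebraMap, ← Complex.ofReal_mul] at h
  generalize aeval ((t : ℂ) * Complex.I) (derivative (besselPoly r)) = u at *
  generalize aeval ((t : ℂ) * Complex.I) (besselPoly r) = v at *
  have hv : Complex.normSq v ≠ 0 := by simpa using ht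
  have hre := congrArg Complex.re h
  simp only [Complex.add_re, Complex.sub_re, Complex.mul_re, Complex.conj_re, Complex.conj_im,
    Complex.ofReal_re] at hre
  rw [Complex.div_re]
  field_simp
  rw [Complex.normSq_apply]
  linarith

theorem iteratedDeriv_pow_mul_eq_zero {h : ℝ → ℝ} {k N : ℕ} (hk : k < N)
    (hh : ContDiffAt ℝ k h 0) : iteratedDeriv k (fun x => x ^ N * h x) 0 = 0 := by
  rw [iteratedDeriv_fun_mul (by fun_prop) hh]
  refine Finset.sum_eq_zero fun i hi => ?_
  have := Finset.mem_range.1 hi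
  rw [iteratedDeriv_pow, zero_pow (by omega)]
  simp

theorem deriv_budak_div {m n : ℕ} {γ : ℝ} {z : ℂ}
    (hm : aeval (2 * ((γ : ℂ) - 1) * z) (besselPoly m) ≠ 0)
    (hn : aeval (2 * (γ : ℂ) * z) (besselPoly n) ≠ 0) :
    deriv (budak m n γ) z / budak m n γ z =
      2 * ((γ : ℂ) - 1) * (aeval (2 * ((γ : ℂ) - 1) * z) (derivative (besselPoly m)) /
        aeval (2 * ((γ : ℂ) - 1) * z) (besselPoly m)) -
      2 * (γ : ℂ) * (aeval (2 * (γ : ℂ) * z) (derivative (besselPoly n)) /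
        aeval (2 * (γ : ℂ) * z) (besselPoly n)) := by
  have hK : (budakK m n : ℂ) ≠ 0 := by
    rw [Ne, Complex.ofReal_eq_zero, budakK, ← coeff_zero_eq_eval_zero, ← coeff_zero_eq_eval_zero]
    exact div_ne_zero (besselPoly_coeff_zero_ne_zero n) (besselPoly_coeff_zero_ne_zero m)
  have key : ∀ (p : ℝ[X]) (a : ℂ), HasDerivAt (fun w : ℂ => aeval (a * w) p)
      (aeval (a * z) (derivative p) * a) z := fun p a =>
    (p.hasDerivAt_aeval (a * z)).comp z (by simpa using (hasDerivAt_id z).const_mul a)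
  have hd := (((key (besselPoly m) (2 * ((γ : ℂ) - 1))).const_mul (budakK m n : ℂ)).div
    (key (besselPoly n) (2 * (γ : ℂ))) hn).deriv
  have hd' : deriv (budak m n γ) z = _ := hd
  rw [hd', budak]
  field_simp

/-- The exact form of the delay of Budak's function near the origin. -/
theorem groupDelay_budak (m n : ℕ) (γ : ℝ) : ∃ a b : ℝ, ∀ ω : ℝ,
    aeval (((2 * (γ - 1) * ω : ℝ) : ℂ) * Complex.I) (besselPoly m) ≠ 0 →
    aeval (((2 * γ * ω : ℝ) : ℂ) * Complex.I) (besselPoly n) ≠ 0 →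
    groupDelay (budak m n γ) ω = 1 +
      (a * ω ^ (2 * m) /
        Complex.normSq (aeval (((2 * (γ - 1) * ω : ℝ) : ℂ) * Complex.I) (besselPoly m)) +
      b * ω ^ (2 * n) /
        Complex.normSq (aeval (((2 * γ * ω : ℝ) : ℂ) * Complex.I) (besselPoly n))) := by
  obtain ⟨c, hc⟩ := besselPoly_re_div m
  obtain ⟨d, hd⟩ := besselPoly_re_div n
  refine ⟨-(2 * (γ - 1)) * c * (2 * (γ - 1)) ^ (2 * m), 2 * γ * d * (2 * γ) ^ (2 * n),
    fun ω h1 h2 => ?_⟩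
  have e1 : 2 * ((γ : ℂ) - 1) * ((ω : ℂ) * Complex.I) =
      ((2 * (γ - 1) * ω : ℝ) : ℂ) * Complex.I := by push_cast; ring
  have e2 : 2 * (γ : ℂ) * ((ω : ℂ) * Complex.I) = ((2 * γ * ω : ℝ) : ℂ) * Complex.I := by
    push_cast; ring
  have e3 : 2 * ((γ : ℂ) - 1) = ((2 * (γ - 1) : ℝ) : ℂ) := by push_cast; ring
  have e4 : 2 * (γ : ℂ) = ((2 * γ : ℝ) : ℂ) := by push_cast; ring
  rw [groupDelay, deriv_budak_div (by rwa [e1]) (by rwa [e2]), e1, e2, e3, e4, Complex.sub_re,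
    Complex.re_ofReal_mul, Complex.re_ofReal_mul, hc _ h1, hd _ h2, mul_pow _ ω, mul_pow _ ω]
  ring

theorem contDiff_aeval_mul_I (p : ℝ[X]) (a : ℝ) :
    ContDiff ℝ ⊤ fun ω : ℝ => aeval (((a * ω : ℝ) : ℂ) * Complex.I) p := by
  have h : ContDiff ℝ ⊤ fun ω : ℝ => ((a * ω : ℝ) : ℂ) * Complex.I :=
    (Complex.ofRealCLM.contDiff.comp (contDiff_const.mul contDiff_id)).mul contDiff_const
  simp only [aeval_eq_sum_range]
  exact ContDiff.sum fun i _ => (h.pow i).const_smul _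

theorem aeval_zero_besselPoly_ne_zero (r : ℕ) (a : ℝ) :
    aeval (((a * 0 : ℝ) : ℂ) * Complex.I) (besselPoly r) ≠ 0 := by
  simpa [← coeff_zero_eq_aeval_zero'] using besselPoly_coeff_zero_ne_zero r

theorem eventually_aeval_besselPoly_ne_zero (r : ℕ) (a : ℝ) :
    ∀ᶠ ω : ℝ in nhds 0, aeval (((a * ω : ℝ) : ℂ) * Complex.I) (besselPoly r) ≠ 0 :=
  (contDiff_aeval_mul_I (besselPoly r) a).continuous.continuousAt.eventually_ne
    (aeval_zero_besselPoly_ne_zero r a)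

theorem contDiffAt_div_normSq_besselPoly (r : ℕ) (a : ℝ) {f : ℝ → ℝ} (hf : ContDiff ℝ ⊤ f) :
    ContDiffAt ℝ ⊤ (fun ω : ℝ => f ω /
      Complex.normSq (aeval (((a * ω : ℝ) : ℂ) * Complex.I) (besselPoly r))) 0 := by
  refine hf.contDiffAt.div ?_ (by simpa using aeval_zero_besselPoly_ne_zero r a)
  simp only [Complex.normSq_eq_norm_sq]
  exact ((contDiff_aeval_mul_I (besselPoly r) a).norm_sq ℝ).contDiffAt

/-- for `1 ≤ m ≤ n` and real `γ ∉ {0, 1}`, the group delay `τ` of Budak's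
function `G_{mn}^γ` satisfies `τ(0) = 1` and all derivatives of orders `1, …, 2m−1` vanish
at `0`: the delay approximation is maximally flat of order at least `m`. -/
theorem budak_delay_flat (m n : ℕ) (hm : 1 ≤ m) (hmn : m ≤ n) (γ : ℝ)
    (hγ0 : γ ≠ 0) (hγ1 : γ ≠ 1) :
    groupDelay (budak m n γ) 0 = 1 ∧
    ∀ k : ℕ, 1 ≤ k → k ≤ 2 * m - 1 → iteratedDeriv k (groupDelay (budak m n γ)) 0 = 0 := by
  obtain ⟨a, b, hab⟩ := groupDelay_budak m n γ
  constructor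
  · rw [hab 0 (aeval_zero_besselPoly_ne_zero _ _) (aeval_zero_besselPoly_ne_zero _ _),
      zero_pow (by omega), zero_pow (by omega)]
    simp
  · intro k hk1 hk2
    have hev : groupDelay (budak m n γ) =ᶠ[nhds 0] fun ω : ℝ => 1 + ω ^ (2 * m) *
        (a / Complex.normSq (aeval (((2 * (γ - 1) * ω : ℝ) : ℂ) * Complex.I) (besselPoly m)) +
        b * ω ^ (2 * (n - m)) /
          Complex.normSq (aeval (((2 * γ * ω : ℝ) : ℂ) * Complex.I) (besselPoly n))) := by
      filter_upwards [eventually_aeval_besselPoly_ne_zero m (2 * (γ - 1)),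
        eventually_aeval_besselPoly_ne_zero n (2 * γ)] with ω h1 h2
      rw [hab ω h1 h2, show 2 * n = 2 * m + 2 * (n - m) by omega, pow_add]
      ring
    rw [hev.iteratedDeriv_eq, iteratedDeriv_const_add (by omega)]
    refine iteratedDeriv_pow_mul_eq_zero (by omega) (ContDiffAt.of_le ?_ le_top)
    exact (contDiffAt_div_normSq_besselPoly m _ contDiff_const).add
      (contDiffAt_div_normSq_besselPoly n _ (contDiff_const.mul (contDiff_id.pow _)))
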